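/- If G is a finite simple bipartite graph (i.e., G admits a proper vertex colouring with 2 colours), then the chromatic index of G equals Δ(G), the maximum degree of G (König's edge colouring theorem). -/

import Mathlib

theorem koenig_hall_step {ι : Type*} [Fintype ι] [DecidableEq ι] (d : ℕ) (M : ι → ι → ℕ)
    (hr : ∀ i, ∑ j, M i j = d + 1) (hc : ∀ j, ∑ i, M i j = d + 1) :
    ∃ σ : Equiv.Perm ι, ∀ i, 0 < M i (σ i) := by
  have key := (Finset.all_card_le_biUnion_card_iff_exists_injective
    (fun i => Finset.univ.filter (fun j => 0 < M i j))).1 (by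
      intro S
      set T := S.biUnion (fun i => Finset.univ.filter (fun j => 0 < M i j)) with hT
      have h1 : ∑ i ∈ S, ∑ j ∈ T, M i j = S.card * (d + 1) := by
        rw [← smul_eq_mul, ← Finset.sum_const]
        refine Finset.sum_congr rfl fun i hi => ?_
        rw [← hr i]
        refine Finset.sum_subset (Finset.subset_univ _) fun j _ hj => ?_
        by_contra h
        exact hj (Finset.mem_biUnion.2 ⟨i, hi, by simp; omega⟩)
      have h2 : ∑ j ∈ T, ∑ i ∈ S, M i j ≤ T.card * (d + 1) := by
        rw [← smul_eq_mul, ← Finset.sum_const]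
        refine Finset.sum_le_sum fun j _ => ?_
        rw [← hc j]
        exact Finset.sum_le_sum_of_subset (Finset.subset_univ _)
      rw [Finset.sum_comm, h1] at h2
      exact Nat.le_of_mul_le_mul_right h2 (Nat.succ_pos d))
  obtain ⟨f, hf, hf'⟩ := key
  refine ⟨Equiv.ofBijective f (Finite.injective_iff_bijective.1 hf), fun i => ?_⟩
  simpa using hf' i

theorem koenig_decomp {ι : Type*} [Fintype ι] [DecidableEq ι] (d : ℕ) : ∀ (M : ι → ι → ℕ),
    (∀ i, ∑ j, M i j = d) → (∀ j, ∑ i, M i j = d) →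
    ∃ σ : Fin d → Equiv.Perm ι, ∀ i j, 0 < M i j → ∃ k, σ k i = j := by
  induction d with
  | zero =>
    intro M hr _
    refine ⟨fun k => k.elim0, fun i j h => ?_⟩
    have := hr i
    rw [Finset.sum_eq_zero_iff] at this
    have := this j (Finset.mem_univ _)
    omega
  | succ d ih =>
    intro M hr hc
    obtain ⟨τ, hτ⟩ := koenig_hall_step d M hr hc
    have hle : ∀ i j, (if τ i = j then 1 else 0) ≤ M i j := by
      intro i j
      split_ifs with h
      · subst h; exact hτ i
      · exact Nat.zero_le _
    obtain ⟨σ, hσ⟩ := ih (fun i j => M i j - if τ i = j then 1 else 0)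
      (fun i => by
        rw [Finset.sum_tsub_distrib _ (fun j _ => hle i j), hr i]
        simp)
      (fun j => by
        rw [Finset.sum_tsub_distrib _ (fun i _ => hle i j), hc j]
        simp [← Equiv.eq_symm_apply])
    refine ⟨Fin.cons τ σ, fun i j h => ?_⟩
    by_cases hij : τ i = j
    · exact ⟨0, by simpa using hij⟩
    · obtain ⟨k, hk⟩ := hσ i j (by simpa [hij] using h)
      exact ⟨k.succ, by simpa using hk⟩

theorem koenig_sub {V : Type*} [Fintype V] [DecidableEq V] (d : ℕ) (N : V → V → ℕ)
    (hr : ∀ i, ∑ j, N i j ≤ d) (hc : ∀ j, ∑ i, N i j ≤ d) :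
    ∃ c : V → V → Fin d → Prop, (∀ i j, 0 < N i j → ∃ k, c i j k) ∧
      (∀ i j j' k, c i j k → c i j' k → j = j') ∧
      (∀ i i' j k, c i j k → c i' j k → i = i') := by
  obtain ⟨σ, hσ⟩ := koenig_decomp (ι := V ⊕ V) d
    (fun x y => match x, y with
      | .inl i, .inl j => N i j
      | .inl i, .inr j => if i = j then d - ∑ l, N i l else 0
      | .inr i, .inl j => if i = j then d - ∑ l, N l i else 0
      | .inr i, .inr j => N j i)
    (by
      rintro (i | i)
      · have := hr i
        simp [Fintype.sum_sum_type]; omega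
      · have := hc i
        simp [Fintype.sum_sum_type]; omega)
    (by
      rintro (i | i)
      · have := hc i
        simp [Fintype.sum_sum_type]; omega
      · have := hr i
        simp [Fintype.sum_sum_type]; omega)
  refine ⟨fun i j k => σ k (.inl i) = .inl j, fun i j h => hσ (.inl i) (.inl j) h, ?_, ?_⟩
  · intro i j j' k h h'
    exact Sum.inl_injective (h.symm.trans h')
  · intro i i' j k h h'
    exact Sum.inl_injective ((σ k).injective (h.trans h'.symm))

theorem koenig_upper {V : Type*} [Fintype V] (G : SimpleGraph V)
    [DecidableRel G.Adj] (hbip : G.Colorable 2) : G.lineGraph.Colorable G.maxDegree := by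
  classical
  obtain ⟨C⟩ := hbip
  obtain ⟨c, h1, h2, h3⟩ := koenig_sub G.maxDegree
    (fun u v => if G.Adj u v ∧ C u = 0 then 1 else 0)
    (fun u => by
      refine le_trans ?_ (G.degree_le_maxDegree u)
      rw [← G.card_neighborFinset_eq_degree, Finset.sum_boole, Nat.cast_id]
      refine Finset.card_le_card fun v hv => ?_
      simp at hv ⊢; exact hv.1)
    (fun u => by
      refine le_trans ?_ (G.degree_le_maxDegree u)
      rw [← G.card_neighborFinset_eq_degree, Finset.sum_boole, Nat.cast_id]
      refine Finset.card_le_card fun v hv => ?_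
      simp at hv ⊢; exact hv.1.symm)
  have hor : ∀ e : G.edgeSet, ∃ u v, (e : Sym2 V) = s(u, v) ∧ C u = 0 ∧ C v = 1 ∧
      ∃ k, c u v k := by
    rintro ⟨e, he⟩
    induction e using Sym2.ind with
    | _ u v =>
      have hadj : G.Adj u v := he
      have hne := C.valid hadj
      have : (C u = 0 ∧ C v = 1) ∨ (C v = 0 ∧ C u = 1) := by
        revert hne
        generalize C u = a
        generalize C v = b
        revert a b
        decide
      rcases this with ⟨a, b⟩ | ⟨a, b⟩
      · exact ⟨u, v, rfl, a, b, h1 u v (by simp [hadj, a])⟩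
      · exact ⟨v, u, Sym2.eq_swap, a, b, h1 v u (by simp [hadj.symm, a])⟩
  choose a b hab ha hb k hk using hor
  refine ⟨SimpleGraph.Coloring.mk k fun {e f} hadj heq => ?_⟩
  rw [SimpleGraph.lineGraph_adj_iff_exists] at hadj
  obtain ⟨hne, x, hx, hy⟩ := hadj
  apply hne
  apply Subtype.ext
  have he := hk e
  have hf := hk f
  rw [heq] at he
  rw [hab, Sym2.mem_iff] at hx hy
  rw [hab e, hab f]
  rcases hx with hx | hx <;> rcases hy with hy | hy
  · have hh : a e = a f := hx.symm.trans hy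
    rw [hh] at he ⊢
    rw [h2 _ _ _ _ he hf]
  · have hh : a e = b f := hx.symm.trans hy
    have := ha e
    rw [hh, hb f] at this
    exact absurd this (by decide)
  · have hh : b e = a f := hx.symm.trans hy
    have := hb e
    rw [hh, ha f] at this
    exact absurd this (by decide)
  · have hh : b e = b f := hx.symm.trans hy
    rw [hh] at he ⊢
    rw [h3 _ _ _ _ he hf]

theorem koenig_lower {V : Type*} [Fintype V] (G : SimpleGraph V)
    [DecidableRel G.Adj] (n : ℕ) (h : G.lineGraph.Colorable n) : G.maxDegree ≤ n := by
  obtain ⟨C⟩ := h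
  refine G.maxDegree_le_of_forall_degree_le n fun v => ?_
  rw [← G.card_neighborSet_eq_degree]
  conv_rhs => rw [← Fintype.card_fin n]
  refine Fintype.card_le_of_injective
    (fun w : G.neighborSet v => C ⟨s(v, w), w.2⟩) fun w w' hw => ?_
  by_contra hne
  refine C.valid (SimpleGraph.lineGraph_adj_iff_exists.2 ⟨?_, v, ?_, ?_⟩) hw
  · intro h
    have h := congrArg Subtype.val h
    exact hne (Subtype.ext (Sym2.congr_right.1 h))
  · simp
  · simp

/-- **König's edge colouring theorem.** If a finite simple graph `G` is bipartite
(i.e. properly vertex-colourable with 2 colours), then its chromatic index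
(the chromatic number of its line graph) equals its maximum degree `Δ(G)`. -/
theorem koenig_edge_coloring {V : Type*} [Fintype V] (G : SimpleGraph V)
    [DecidableRel G.Adj] (hbip : G.Colorable 2) :
    (G.lineGraph).chromaticNumber = (G.maxDegree : ℕ∞) := by
  refine le_antisymm (koenig_upper G hbip).chromaticNumber_le ?_
  refine le_iInf₂ fun n hn => ?_
  exact_mod_cast koenig_lower G n hn
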